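/- The shearlet synthesis operator 𝒮^t : (F,ψ) ↦ 𝒮^t_ψ F is a continuous bilinear map from 𝒮(𝕊) × S_0(ℝ²) into S_0(ℝ²); in particular 𝒮^t_ψ F is a Schwartz function with all moments vanishing whenever F ∈ 𝒮(𝕊) and ψ ∈ S_0(ℝ²). -/

import Mathlib

open MeasureTheory Complex SchwartzMap
open scoped FourierTransform RealInnerProductSpace

noncomputable section

abbrev E2 := EuclideanSpace ℝ (Fin 2)

/-- construct a point of ℝ² -/
def e2 (u v : ℝ) : E2 := (WithLp.equiv 2 (Fin 2 → ℝ)).symm ![u, v]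

/-- Japanese bracket ⟨x⟩ = (1+‖x‖²)^{1/2}. -/
def jp {E : Type*} [NormedAddCommGroup E] (x : E) : ℝ := Real.sqrt (1 + ‖x‖^2)

/-- Schwartz seminorms ρ_ν. -/
def rho {E : Type*} [NormedAddCommGroup E] [NormedSpace ℝ E] (ν : ℕ) (f : E → ℂ) : ℝ :=
  ⨆ p : E × Fin (ν + 1), jp p.1 ^ ν * ‖iteratedFDeriv ℝ p.2 f p.1‖

/-- Lizorkin membership on ℝ²: Schwartz with all vanishing moments. -/
def IsLizorkin2 (f : E2 → ℂ) : Prop :=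
  (∃ g : SchwartzMap E2 ℂ, ⇑g = f) ∧
    ∀ m₁ m₂ : ℕ, ∫ x : E2, ((x 0) ^ m₁ * (x 1) ^ m₂ : ℝ) • f x = 0

/-- shearlet representation π_{b,s,a}ψ -/
def srep (ψ : E2 → ℂ) (b : E2) (s a : ℝ) (x : E2) : ℂ :=
  (|a| ^ (-(3:ℝ)/4) : ℝ) •
    ψ (e2 ((x 0 - b 0 + s * (x 1 - b 1)) / a) (Real.sqrt |a| * (x 1 - b 1) / a))

/-- shearlet transform 𝒮_ψ f (b,s,a) = ⟨f, π_{b,s,a}ψ⟩ -/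
def sTrans (ψ f : E2 → ℂ) (b : E2) (s a : ℝ) : ℂ :=
  ∫ x : E2, f x * (starRingEnd ℂ) (srep ψ b s a x)

/-- shearlet synthesis operator -/
def sSynth (ψ : E2 → ℂ) (Φ : ℝ → ℝ → ℝ → ℝ → ℂ) (x : E2) : ℂ :=
  ∫ p : ℝ × ℝ × ℝ × ℝ,
    (|p.2.2.2| ^ (-(3:ℝ)) : ℝ) •
      (Φ p.1 p.2.1 p.2.2.1 p.2.2.2 * srep ψ (e2 p.1 p.2.1) p.2.2.1 p.2.2.2 x)

/-- mixed partial derivative ∂_a^γ ∂_s^β ∂_{b₂}^{α₂} ∂_{b₁}^{α₁} Φ -/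
def mixedD (α₁ α₂ β γ : ℕ) (Φ : ℝ → ℝ → ℝ → ℝ → ℂ) (b₁ b₂ s a : ℝ) : ℂ :=
  iteratedDeriv γ (fun a' => iteratedDeriv β (fun s' =>
    iteratedDeriv α₂ (fun y => iteratedDeriv α₁ (fun x => Φ x y s' a') b₁) b₂) s) a

/-- the weight in the norms of 𝒮(𝕊), with real exponent m -/
def wS (k₁ k₂ l : ℕ) (m : ℝ) (b₁ b₂ s a : ℝ) : ℝ :=
  jp b₁ ^ k₁ * jp b₂ ^ k₂ * jp s ^ l * (|a| ^ m + |a| ^ (-m))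

/-- the norms p^{α₁,α₂,β,γ}_{k₁,k₂,l,m} on 𝒮(𝕊) -/
def pN (k₁ k₂ l : ℕ) (m : ℝ) (α₁ α₂ β γ : ℕ) (Φ : ℝ → ℝ → ℝ → ℝ → ℂ) : ℝ :=
  ⨆ q : ℝ × ℝ × ℝ × {a : ℝ // a ≠ 0},
    wS k₁ k₂ l m q.1 q.2.1 q.2.2.1 q.2.2.2 *
      ‖mixedD α₁ α₂ β γ Φ q.1 q.2.1 q.2.2.1 q.2.2.2‖

/-- membership in the test function space 𝒮(𝕊) -/
def MemSS (Φ : ℝ → ℝ → ℝ → ℝ → ℂ) : Prop :=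
  ContDiffOn ℝ (⊤ : ℕ∞) (fun p : ℝ × ℝ × ℝ × ℝ => Φ p.1 p.2.1 p.2.2.1 p.2.2.2)
      {p : ℝ × ℝ × ℝ × ℝ | p.2.2.2 ≠ 0} ∧
    ∀ k₁ k₂ l m α₁ α₂ β γ : ℕ, ∃ C : ℝ, ∀ b₁ b₂ s a : ℝ, a ≠ 0 →
      wS k₁ k₂ l (m : ℝ) b₁ b₂ s a * ‖mixedD α₁ α₂ β γ Φ b₁ b₂ s a‖ ≤ C


/-- Differentiation under the integral sign, to all orders. -/
theorem hasFTaylorSeriesUpTo_integral {α E F : Type*} [MeasurableSpace α] {μ : Measure α}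
    [NormedAddCommGroup E] [NormedSpace ℝ E] [NormedAddCommGroup F] [NormedSpace ℝ F]
    [CompleteSpace F] {f : α → E → F} {bound : ℕ → α → ℝ}
    (hf : ∀ a, ContDiff ℝ (⊤ : ℕ∞) (f a))
    (hmeas : ∀ n x, AEStronglyMeasurable (fun a => iteratedFDeriv ℝ n (f a) x) μ)
    (hbound : ∀ n a x, ‖iteratedFDeriv ℝ n (f a) x‖ ≤ bound n a)
    (hint : ∀ n, Integrable (bound n) μ) :
    HasFTaylorSeriesUpTo (⊤ : ℕ∞) (fun x => ∫ a, f a x ∂μ)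
      (fun x n => ∫ a, iteratedFDeriv ℝ n (f a) x ∂μ) := by
  have hI : ∀ n x, Integrable (fun a => iteratedFDeriv ℝ n (f a) x) μ := fun n x =>
    (hint n).mono' (hmeas n x) (Filter.Eventually.of_forall fun a => hbound n a x)
  have hD : ∀ n x, HasFDerivAt (fun x => ∫ a, iteratedFDeriv ℝ n (f a) x ∂μ)
      ((∫ a, iteratedFDeriv ℝ (n + 1) (f a) x ∂μ).curryLeft) x := by
    intro n x
    let L : (ContinuousMultilinearMap ℝ (fun _ : Fin (n + 1) => E) F) →L[ℝ]
        (E →L[ℝ] ContinuousMultilinearMap ℝ (fun _ : Fin n => E) F) :=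
      (continuousMultilinearCurryLeftEquiv ℝ (fun _ : Fin (n + 1) => E) F
      ).toContinuousLinearEquiv.toContinuousLinearMap
    have hL : (∫ a, iteratedFDeriv ℝ (n + 1) (f a) x ∂μ).curryLeft =
        ∫ a, (iteratedFDeriv ℝ (n + 1) (f a) x).curryLeft ∂μ := by
      have h := ContinuousLinearMap.integral_comp_comm (𝕜 := ℝ)
        (Fₗ := E →L[ℝ] ContinuousMultilinearMap ℝ (fun _ : Fin n => E) F) L (hI (n + 1) x)
      exact h.symm
    rw [hL]
    refine hasFDerivAt_integral_of_dominated_of_fderiv_le (bound := bound (n + 1))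
      (F' := fun x a => (iteratedFDeriv ℝ (n + 1) (f a) x).curryLeft)
      Filter.univ_mem (Filter.Eventually.of_forall fun x => hmeas n x) (hI n x)
      (L.continuous.comp_aestronglyMeasurable (hmeas (n + 1) x))
      (Filter.Eventually.of_forall fun a x _ => ?_) (hint (n + 1))
      (Filter.Eventually.of_forall fun a x _ => ?_)
    · rw [ContinuousMultilinearMap.curryLeft_norm]
      exact hbound (n + 1) a x
    · exact (contDiff_iff_ftaylorSeries.1 (hf a)).fderiv n
        (by exact_mod_cast ENat.natCast_lt_top n) x
  refine ⟨fun x => ?_, fun n _ x => hD n x, fun n _ =>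
    continuous_iff_continuousAt.2 fun x => (hD n x).continuousAt⟩
  have h0 := ((continuousMultilinearCurryFin0 ℝ E F).toContinuousLinearEquiv.toContinuousLinearMap
    ).integral_comp_comm (hI 0 x)
  simpa [iteratedFDeriv_zero_eq_comp] using h0.symm

theorem one_le_jp {E : Type*} [NormedAddCommGroup E] (x : E) : 1 ≤ jp x :=
  Real.one_le_sqrt.2 (by nlinarith [norm_nonneg x])

theorem jp_pos {E : Type*} [NormedAddCommGroup E] (x : E) : 0 < jp x :=
  zero_lt_one.trans_le (one_le_jp x)

theorem jp_sq {E : Type*} [NormedAddCommGroup E] (x : E) : jp x ^ 2 = 1 + ‖x‖ ^ 2 :=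
  Real.sq_sqrt (by positivity)

theorem norm_le_jp {E : Type*} [NormedAddCommGroup E] (x : E) : ‖x‖ ≤ jp x :=
  Real.le_sqrt_of_sq_le (by linarith)

theorem jp_le_one_add_norm {E : Type*} [NormedAddCommGroup E] (x : E) : jp x ≤ 1 + ‖x‖ :=
  Real.sqrt_le_iff.2 ⟨by positivity, by nlinarith [norm_nonneg x]⟩

theorem one_add_norm_le_two_mul_jp {E : Type*} [NormedAddCommGroup E] (x : E) :
    1 + ‖x‖ ≤ 2 * jp x := by
  linarith [one_le_jp x, norm_le_jp x]

/-- Peetre's inequality. -/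
theorem jp_add_le {E : Type*} [NormedAddCommGroup E] (x y : E) :
    jp (x + y) ≤ 2 * jp x * jp y := by
  refine Real.sqrt_le_iff.2 ⟨by have := jp_pos x; have := jp_pos y; positivity, ?_⟩
  rw [mul_pow, mul_pow, jp_sq, jp_sq]
  have h := norm_add_le x y
  have h1 : ‖x + y‖ ^ 2 ≤ (‖x‖ + ‖y‖) ^ 2 := by gcongr
  nlinarith [sq_nonneg (‖x‖ - ‖y‖), sq_nonneg (‖x‖ * ‖y‖), sq_nonneg ‖x‖, sq_nonneg ‖y‖]

theorem jp_le_mul_jp {E F : Type*} [NormedAddCommGroup E] [NormedAddCommGroup F] {x : E} {y : F}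
    {K : ℝ} (hK : 1 ≤ K) (h : ‖x‖ ≤ K * ‖y‖) : jp x ≤ K * jp y := by
  have hy := jp_pos y
  refine Real.sqrt_le_iff.2 ⟨by positivity, ?_⟩
  rw [mul_pow, jp_sq]
  have h1 : ‖x‖ ^ 2 ≤ (K * ‖y‖) ^ 2 := by gcongr
  nlinarith

@[simp] theorem e2_zero (u v : ℝ) : e2 u v 0 = u := rfl

@[simp] theorem e2_one (u v : ℝ) : e2 u v 1 = v := rfl

theorem norm_sq_E2 (x : E2) : ‖x‖ ^ 2 = x 0 ^ 2 + x 1 ^ 2 := by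
  simp [EuclideanSpace.norm_sq_eq, Fin.sum_univ_two]

theorem abs_apply_le (x : E2) (i : Fin 2) : |x i| ≤ ‖x‖ := PiLp.norm_apply_le x i

theorem norm_le_abs_add_abs (x : E2) : ‖x‖ ≤ |x 0| + |x 1| := by
  refine abs_le_of_sq_le_sq' ?_ (by positivity) |>.2
  rw [norm_sq_E2]
  nlinarith [sq_abs (x 0), sq_abs (x 1), abs_nonneg (x 0), abs_nonneg (x 1)]

theorem jp_e2_le (u v : ℝ) : jp (e2 u v) ≤ jp u * jp v := by
  refine Real.sqrt_le_iff.2 ⟨(mul_pos (jp_pos u) (jp_pos v)).le, ?_⟩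
  rw [mul_pow, jp_sq, jp_sq, norm_sq_E2]
  simp only [e2_zero, e2_one, Real.norm_eq_abs, sq_abs]
  nlinarith [mul_nonneg (sq_nonneg u) (sq_nonneg v)]

/-- The linear map `A_a⁻¹ N_s⁻¹` acting on the argument of a shearlet. -/
def shearDilation (s a : ℝ) : E2 →L[ℝ] E2 :=
  a⁻¹ • (EuclideanSpace.proj 0).smulRight (e2 1 0) +
    (s * a⁻¹) • (EuclideanSpace.proj 1).smulRight (e2 1 0) +
      (√|a| * a⁻¹) • (EuclideanSpace.proj 1).smulRight (e2 0 1)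

theorem shearDilation_zero (s a : ℝ) (x : E2) :
    shearDilation s a x 0 = (x 0 + s * x 1) / a := by
  simp [shearDilation]
  ring

theorem shearDilation_one (s a : ℝ) (x : E2) :
    shearDilation s a x 1 = √|a| * x 1 / a := by
  simp [shearDilation]
  ring

/-- A symmetric weight dominating the powers `|a| ^ r` for `|r| ≤ 1`. -/
def dilationWeight (a : ℝ) : ℝ := |a| + |a|⁻¹

theorem one_add_sq_le_dilationWeight_sq {a : ℝ} (ha : a ≠ 0) :
    1 + a ^ 2 ≤ dilationWeight a ^ 2 := by
  have h : |a| * |a|⁻¹ = 1 := mul_inv_cancel₀ (abs_pos.2 ha).ne'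
  unfold dilationWeight
  nlinarith [sq_abs a, sq_nonneg (|a|⁻¹)]

theorem one_le_dilationWeight {a : ℝ} (ha : a ≠ 0) : 1 ≤ dilationWeight a := by
  have h := one_add_sq_le_dilationWeight_sq ha
  have : 0 ≤ dilationWeight a := by unfold dilationWeight; positivity
  nlinarith [sq_nonneg a]

theorem rpow_le_dilationWeight {a r : ℝ} (ha : a ≠ 0) (h₁ : -1 ≤ r) (h₂ : r ≤ 1) :
    |a| ^ r ≤ dilationWeight a := by
  have hp := abs_pos.2 ha
  unfold dilationWeight
  rcases le_total 1 |a| with h | h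
  · have := Real.rpow_le_rpow_of_exponent_le h h₂
    rw [Real.rpow_one] at this
    have : 0 < |a|⁻¹ := by positivity
    linarith
  · have := Real.rpow_le_rpow_of_exponent_ge hp h h₁
    rw [Real.rpow_neg_one] at this
    linarith

theorem dilationWeight_pow_le {a : ℝ} (ha : a ≠ 0) (m : ℕ) :
    dilationWeight a ^ m ≤ 2 ^ m * (|a| ^ (m : ℝ) + |a| ^ (-(m : ℝ))) := by
  have hp := abs_pos.2 ha
  rw [Real.rpow_neg hp.le, Real.rpow_natCast, ← inv_pow]
  have hi : 0 < |a|⁻¹ := by positivity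
  have h : dilationWeight a ≤ 2 * max |a| |a|⁻¹ := by
    unfold dilationWeight
    linarith [le_max_left |a| |a|⁻¹, le_max_right |a| |a|⁻¹]
  have h0 : 0 ≤ dilationWeight a := by unfold dilationWeight; positivity
  calc dilationWeight a ^ m ≤ (2 * max |a| |a|⁻¹) ^ m := by gcongr
    _ = 2 ^ m * max |a| |a|⁻¹ ^ m := mul_pow _ _ _
    _ ≤ _ := by
      gcongr
      rcases max_choice |a| |a|⁻¹ with h | h <;> rw [h]
      · linarith [pow_pos hi m]
      · linarith [pow_pos hp m]

theorem sqrt_abs_le_dilationWeight {a : ℝ} (ha : a ≠ 0) : √|a| ≤ dilationWeight a := by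
  rw [Real.sqrt_eq_rpow]
  exact rpow_le_dilationWeight ha (by norm_num) (by norm_num)

theorem sqrt_abs_mul_inv_le_dilationWeight {a : ℝ} (ha : a ≠ 0) :
    √|a| * |a|⁻¹ ≤ dilationWeight a := by
  have hp := abs_pos.2 ha
  rw [Real.sqrt_eq_rpow, ← Real.rpow_neg_one, ← Real.rpow_add hp]
  exact rpow_le_dilationWeight ha (by norm_num) (by norm_num)

theorem norm_shearDilation_apply_le {a : ℝ} (ha : a ≠ 0) (s : ℝ) (x : E2) :
    ‖shearDilation s a x‖ ≤ 3 * jp s * dilationWeight a * ‖x‖ := by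
  have hp := abs_pos.2 ha
  have hs : |s| ≤ jp s := norm_le_jp s
  have hs1 := one_le_jp s
  have hw : |a|⁻¹ ≤ dilationWeight a := by unfold dilationWeight; linarith
  have hw1 := one_le_dilationWeight ha
  have hq := sqrt_abs_mul_inv_le_dilationWeight ha
  have hb : |shearDilation s a x 0| ≤ |a|⁻¹ * |x 0| + |s| * |a|⁻¹ * |x 1| := by
    rw [shearDilation_zero, abs_div, div_eq_mul_inv]
    have := abs_add_le (x 0) (s * x 1)
    rw [abs_mul] at this
    calc _ ≤ (|x 0| + |s| * |x 1|) * |a|⁻¹ := by gcongr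
      _ = _ := by ring
  have hc : |shearDilation s a x 1| = √|a| * |a|⁻¹ * |x 1| := by
    rw [shearDilation_one, abs_div, abs_mul, abs_of_nonneg (Real.sqrt_nonneg _)]
    ring
  calc ‖shearDilation s a x‖ ≤ |a|⁻¹ * |x 0| + |s| * |a|⁻¹ * |x 1| + √|a| * |a|⁻¹ * |x 1| := by
        linarith [norm_le_abs_add_abs (shearDilation s a x)]
    _ ≤ 1 * dilationWeight a * ‖x‖ + jp s * dilationWeight a * ‖x‖ +
          1 * dilationWeight a * ‖x‖ := by
        rw [one_mul]
        gcongr <;> exact abs_apply_le x _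
    _ ≤ jp s * dilationWeight a * ‖x‖ + jp s * dilationWeight a * ‖x‖ +
          jp s * dilationWeight a * ‖x‖ := by gcongr
    _ = _ := by ring

theorem norm_le_norm_shearDilation_apply {a : ℝ} (ha : a ≠ 0) (s : ℝ) (x : E2) :
    ‖x‖ ≤ 3 * jp s * dilationWeight a * ‖shearDilation s a x‖ := by
  have hp := abs_pos.2 ha
  have hs : |s| ≤ jp s := norm_le_jp s
  have hs1 := one_le_jp s
  have hw : |a| ≤ dilationWeight a := by
    unfold dilationWeight; linarith [inv_pos.2 hp]
  have hw1 := one_le_dilationWeight ha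
  have hq := sqrt_abs_le_dilationWeight ha
  set y := shearDilation s a x with hy
  have h1 : |x 1| = √|a| * |y 1| := by
    rw [hy, shearDilation_one, abs_div, abs_mul, abs_of_nonneg (Real.sqrt_nonneg _)]
    field_simp
    rw [Real.sq_sqrt hp.le]
  have h0 : |x 0| ≤ |a| * |y 0| + |s| * |x 1| := by
    have : x 0 = a * y 0 - s * x 1 := by
      rw [hy, shearDilation_zero]
      field_simp
      ring
    rw [this, ← abs_mul, ← abs_mul]
    exact abs_sub _ _
  calc ‖x‖ ≤ |a| * |y 0| + |s| * (√|a| * |y 1|) + √|a| * |y 1| := by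
        rw [← h1]; linarith [norm_le_abs_add_abs x]
    _ ≤ 1 * (dilationWeight a * ‖y‖) + jp s * (dilationWeight a * ‖y‖) +
          1 * (dilationWeight a * ‖y‖) := by
        rw [one_mul]
        gcongr <;> exact abs_apply_le y _
    _ ≤ jp s * (dilationWeight a * ‖y‖) + jp s * (dilationWeight a * ‖y‖) +
          jp s * (dilationWeight a * ‖y‖) := by gcongr
    _ = _ := by ring

theorem bddAbove_rho {E : Type*} [NormedAddCommGroup E] [NormedSpace ℝ E] (ν : ℕ)
    (f : SchwartzMap E ℂ) : BddAbove (Set.range fun p : E × Fin (ν + 1) =>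
      jp p.1 ^ ν * ‖iteratedFDeriv ℝ p.2 f p.1‖) := by
  refine ⟨2 ^ ν * ((Finset.Iic (ν, ν)).sup fun m => SchwartzMap.seminorm ℝ m.1 m.2) f, ?_⟩
  rintro _ ⟨⟨x, n⟩, rfl⟩
  refine le_trans ?_ (SchwartzMap.one_add_le_sup_seminorm_apply (𝕜 := ℝ) (m := (ν, ν)) (le_refl ν)
    (Nat.lt_succ_iff.1 n.2) f x)
  have := jp_pos x
  exact mul_le_mul_of_nonneg_right (pow_le_pow_left₀ this.le (jp_le_one_add_norm x) ν)
    (norm_nonneg _)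

theorem le_rho {E : Type*} [NormedAddCommGroup E] [NormedSpace ℝ E] {ν n : ℕ} (hn : n ≤ ν)
    (f : SchwartzMap E ℂ) (x : E) : jp x ^ ν * ‖iteratedFDeriv ℝ n f x‖ ≤ rho ν f :=
  le_ciSup (bddAbove_rho ν f) (x, (⟨n, Nat.lt_succ_of_le hn⟩ : Fin (ν + 1)))

theorem rho_nonneg {E : Type*} [NormedAddCommGroup E] [NormedSpace ℝ E] (ν : ℕ) (f : E → ℂ) :
    0 ≤ rho ν f :=
  Real.iSup_nonneg fun p => by have := jp_pos p.1; positivity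

theorem le_pN {Φ : ℝ → ℝ → ℝ → ℝ → ℂ} (hΦ : MemSS Φ) (k₁ k₂ l m : ℕ) (b₁ b₂ s : ℝ) {a : ℝ}
    (ha : a ≠ 0) : wS k₁ k₂ l m b₁ b₂ s a * ‖Φ b₁ b₂ s a‖ ≤ pN k₁ k₂ l m 0 0 0 0 Φ := by
  obtain ⟨C, hC⟩ := hΦ.2 k₁ k₂ l m 0 0 0 0
  have hb : BddAbove (Set.range fun q : ℝ × ℝ × ℝ × {a : ℝ // a ≠ 0} =>
      wS k₁ k₂ l m q.1 q.2.1 q.2.2.1 q.2.2.2 *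
        ‖mixedD 0 0 0 0 Φ q.1 q.2.1 q.2.2.1 q.2.2.2‖) := by
    refine ⟨C, ?_⟩
    rintro _ ⟨q, rfl⟩
    exact hC _ _ _ _ q.2.2.2.2
  have h := le_ciSup hb (b₁, b₂, s, ⟨a, ha⟩)
  simpa [pN, mixedD] using h

theorem pN_nonneg {Φ : ℝ → ℝ → ℝ → ℝ → ℂ} (hΦ : MemSS Φ) (k₁ k₂ l m : ℕ) :
    0 ≤ pN k₁ k₂ l m 0 0 0 0 Φ := by
  refine le_trans ?_ (le_pN hΦ k₁ k₂ l m 0 0 0 one_ne_zero)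
  have := jp_pos (0 : ℝ)
  unfold wS
  positivity

/-- The scalar factor multiplying the sheared and dilated copy of `ψ` in the synthesis integral. -/
def synthCoeff (Φ : ℝ → ℝ → ℝ → ℝ → ℂ) (p : ℝ × ℝ × ℝ × ℝ) : ℂ :=
  (|p.2.2.2| ^ (-(3 : ℝ)) * |p.2.2.2| ^ (-(3 : ℝ) / 4) : ℝ) • Φ p.1 p.2.1 p.2.2.1 p.2.2.2

/-- The integrand of the synthesis operator. -/
def synthAtom (ψ : E2 → ℂ) (Φ : ℝ → ℝ → ℝ → ℝ → ℂ) (p : ℝ × ℝ × ℝ × ℝ) (x : E2) : ℂ :=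
  synthCoeff Φ p • ψ (shearDilation p.2.2.1 p.2.2.2 (x - e2 p.1 p.2.1))

theorem sSynth_eq (ψ : E2 → ℂ) (Φ : ℝ → ℝ → ℝ → ℝ → ℂ) :
    sSynth ψ Φ = fun x => ∫ p, synthAtom ψ Φ p x := by
  funext x
  refine integral_congr_ae (Filter.Eventually.of_forall fun p => ?_)
  have hy : e2 ((x 0 - p.1 + p.2.2.1 * (x 1 - p.2.1)) / p.2.2.2)
      (√|p.2.2.2| * (x 1 - p.2.1) / p.2.2.2) =
      shearDilation p.2.2.1 p.2.2.2 (x - e2 p.1 p.2.1) := by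
    ext i
    fin_cases i
    · simp [-map_sub, shearDilation_zero]
    · simp [-map_sub, shearDilation_one]
  simp only [srep, synthAtom, synthCoeff, e2_zero, e2_one, hy, Complex.real_smul, smul_eq_mul]
  push_cast
  ring

theorem iteratedFDeriv_synthAtom {ψ : E2 → ℂ} (hψ : ContDiff ℝ (⊤ : ℕ∞) ψ)
    (Φ : ℝ → ℝ → ℝ → ℝ → ℂ) (p : ℝ × ℝ × ℝ × ℝ) (n : ℕ) (x : E2) :
    iteratedFDeriv ℝ n (synthAtom ψ Φ p) x = synthCoeff Φ p •
      (iteratedFDeriv ℝ n ψ (shearDilation p.2.2.1 p.2.2.2 (x - e2 p.1 p.2.1))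
        ).compContinuousLinearMap fun _ => shearDilation p.2.2.1 p.2.2.2 := by
  set M := shearDilation p.2.2.1 p.2.2.2
  have hn : (n : WithTop ℕ∞) ≤ (⊤ : ℕ∞) := by exact_mod_cast le_top
  have hc : ContDiff ℝ (⊤ : ℕ∞) fun x => ψ (M (x - e2 p.1 p.2.1)) := by fun_prop
  have h := iteratedFDeriv_const_smul_apply (a := synthCoeff Φ p) (x := x)
    ((hc.of_le hn).contDiffAt)
  refine h.trans ?_
  rw [iteratedFDeriv_comp_sub (f := fun x => ψ (M x))]
  exact congrArg _ (M.iteratedFDeriv_comp_right hψ _ hn)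

theorem contDiff_synthAtom {ψ : E2 → ℂ} (hψ : ContDiff ℝ (⊤ : ℕ∞) ψ)
    (Φ : ℝ → ℝ → ℝ → ℝ → ℂ) (p : ℝ × ℝ × ℝ × ℝ) :
    ContDiff ℝ (⊤ : ℕ∞) (synthAtom ψ Φ p) := by
  unfold synthAtom
  fun_prop

theorem synthCoeff_eq_zero (Φ : ℝ → ℝ → ℝ → ℝ → ℂ) {p : ℝ × ℝ × ℝ × ℝ} (hp : p.2.2.2 = 0) :
    synthCoeff Φ p = 0 := by
  simp [synthCoeff, hp, Real.zero_rpow]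

theorem norm_synthCoeff_le (Φ : ℝ → ℝ → ℝ → ℝ → ℂ) {p : ℝ × ℝ × ℝ × ℝ} (hp : p.2.2.2 ≠ 0) :
    ‖synthCoeff Φ p‖ ≤ dilationWeight p.2.2.2 ^ 4 * ‖Φ p.1 p.2.1 p.2.2.1 p.2.2.2‖ := by
  have ha := abs_pos.2 hp
  have h1 : |p.2.2.2| ^ (-(3 : ℝ)) ≤ dilationWeight p.2.2.2 ^ 3 := by
    rw [show (-(3 : ℝ)) = (-1) * (3 : ℕ) by norm_num, Real.rpow_mul ha.le, Real.rpow_natCast]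
    gcongr
    exact rpow_le_dilationWeight hp le_rfl (by norm_num)
  have h2 : |p.2.2.2| ^ (-(3 : ℝ) / 4) ≤ dilationWeight p.2.2.2 :=
    rpow_le_dilationWeight hp (by norm_num) (by norm_num)
  have hw := one_le_dilationWeight hp
  rw [synthCoeff, norm_smul, Real.norm_of_nonneg (by positivity), pow_succ]
  gcongr

/-- An integrable majorant on the parameter space. -/
def cauchyDensity (p : ℝ × ℝ × ℝ × ℝ) : ℝ :=
  (1 + p.1 ^ 2)⁻¹ * ((1 + p.2.1 ^ 2)⁻¹ * ((1 + p.2.2.1 ^ 2)⁻¹ * (1 + p.2.2.2 ^ 2)⁻¹))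

theorem integrable_cauchyDensity : Integrable cauchyDensity :=
  integrable_inv_one_add_sq.mul_prod (integrable_inv_one_add_sq.mul_prod
    (integrable_inv_one_add_sq.mul_prod integrable_inv_one_add_sq))

theorem cauchyDensity_nonneg (p : ℝ × ℝ × ℝ × ℝ) : 0 ≤ cauchyDensity p := by
  unfold cauchyDensity
  positivity

theorem weight_mul_norm_le {Φ : ℝ → ℝ → ℝ → ℝ → ℂ} (hΦ : MemSS Φ) (ν : ℕ) (b₁ b₂ s : ℝ) {a : ℝ}
    (ha : a ≠ 0) :
    (jp b₁ * jp b₂) ^ ν * jp s ^ (2 * ν) * dilationWeight a ^ (2 * ν + 4) * ‖Φ b₁ b₂ s a‖ ≤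
      2 ^ (2 * ν + 6) * pN (ν + 2) (ν + 2) (2 * ν + 2) (2 * ν + 6 : ℕ) 0 0 0 0 Φ *
        cauchyDensity (b₁, b₂, s, a) := by
  have h := le_pN hΦ (ν + 2) (ν + 2) (2 * ν + 2) (2 * ν + 6) b₁ b₂ s ha
  have hw := dilationWeight_pow_le ha (2 * ν + 6)
  have hW := one_add_sq_le_dilationWeight_sq ha
  have hW1 := one_le_dilationWeight ha
  have hj₁ := jp_pos b₁
  have hj₂ := jp_pos b₂
  have hs := jp_pos s
  have e₁ : 1 + b₁ ^ 2 = jp b₁ ^ 2 := by simp [jp_sq]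
  have e₂ : 1 + b₂ ^ 2 = jp b₂ ^ 2 := by simp [jp_sq]
  have e₃ : 1 + s ^ 2 = jp s ^ 2 := by simp [jp_sq]
  have hD : cauchyDensity (b₁, b₂, s, a) =
      (jp b₁ ^ 2 * jp b₂ ^ 2 * jp s ^ 2 * (1 + a ^ 2))⁻¹ := by
    simp only [cauchyDensity, e₁, e₂, e₃, mul_inv]
    ring
  rw [hD, ← div_eq_mul_inv, le_div_iff₀ (by positivity)]
  calc _ ≤ (jp b₁ * jp b₂) ^ ν * jp s ^ (2 * ν) * dilationWeight a ^ (2 * ν + 4) *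
          ‖Φ b₁ b₂ s a‖ * (jp b₁ ^ 2 * jp b₂ ^ 2 * jp s ^ 2 * dilationWeight a ^ 2) := by gcongr
    _ = jp b₁ ^ (ν + 2) * jp b₂ ^ (ν + 2) * jp s ^ (2 * ν + 2) * dilationWeight a ^ (2 * ν + 6) *
          ‖Φ b₁ b₂ s a‖ := by ring
    _ ≤ jp b₁ ^ (ν + 2) * jp b₂ ^ (ν + 2) * jp s ^ (2 * ν + 2) *
          (2 ^ (2 * ν + 6) * (|a| ^ ((2 * ν + 6 : ℕ) : ℝ) + |a| ^ (-((2 * ν + 6 : ℕ) : ℝ)))) *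
          ‖Φ b₁ b₂ s a‖ := by gcongr
    _ = 2 ^ (2 * ν + 6) * (wS (ν + 2) (ν + 2) (2 * ν + 2) (2 * ν + 6 : ℕ) b₁ b₂ s a *
          ‖Φ b₁ b₂ s a‖) := by unfold wS; ring
    _ ≤ _ := by gcongr

/-- The constant in the continuity estimate of order `ν`. -/
def synthConst (ν : ℕ) : ℝ := 18 ^ ν * 2 ^ (2 * ν + 6)

theorem jp_pow_mul_norm_iteratedFDeriv_synthAtom_le {Φ : ℝ → ℝ → ℝ → ℝ → ℂ} (hΦ : MemSS Φ)
    (ψ : SchwartzMap E2 ℂ) {ν n : ℕ} (hn : n ≤ ν) (p : ℝ × ℝ × ℝ × ℝ) (x : E2) :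
    jp x ^ ν * ‖iteratedFDeriv ℝ n (synthAtom ψ Φ p) x‖ ≤
      synthConst ν * pN (ν + 2) (ν + 2) (2 * ν + 2) (2 * ν + 6 : ℕ) 0 0 0 0 Φ * rho ν ψ *
        cauchyDensity p := by
  have hP := pN_nonneg hΦ (ν + 2) (ν + 2) (2 * ν + 2) (2 * ν + 6)
  have hρ := rho_nonneg ν ψ
  have hd := cauchyDensity_nonneg p
  rw [iteratedFDeriv_synthAtom (ψ.smooth _)]
  obtain ⟨b₁, b₂, s, a⟩ := p
  rcases eq_or_ne a 0 with ha | ha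
  · rw [synthCoeff_eq_zero Φ ha, zero_smul, norm_zero, mul_zero]
    unfold synthConst
    positivity
  have hc := norm_synthCoeff_le Φ (p := (b₁, b₂, s, a)) ha
  have hm := weight_mul_norm_le hΦ ν b₁ b₂ s ha
  have hW := one_le_dilationWeight ha
  have hS := one_le_jp s
  have hj₁ := jp_pos b₁
  have hj₂ := jp_pos b₂
  have hx := jp_pos x
  dsimp only at *
  set M := shearDilation s a with hM
  set y := M (x - e2 b₁ b₂) with hy
  set K := 3 * jp s * dilationWeight a with hK
  have hK1 : 1 ≤ K := by nlinarith
  have hMK : ‖M‖ ≤ K := M.opNorm_le_bound (by positivity) (norm_shearDilation_apply_le ha s)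
  have hyx : jp (x - e2 b₁ b₂) ≤ K * jp y :=
    jp_le_mul_jp hK1 (norm_le_norm_shearDilation_apply ha s _)
  have hyp := jp_pos y
  have hbp := jp_pos (e2 b₁ b₂)
  have hxp := jp_pos (x - e2 b₁ b₂)
  have hxy : jp x ≤ 2 * (jp b₁ * jp b₂) * (K * jp y) := by
    calc jp x = jp (e2 b₁ b₂ + (x - e2 b₁ b₂)) := by rw [add_sub_cancel]
      _ ≤ 2 * jp (e2 b₁ b₂) * jp (x - e2 b₁ b₂) := jp_add_le _ _
      _ ≤ _ := by
        gcongr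
        exact jp_e2_le b₁ b₂
  have hcomp : ‖(iteratedFDeriv ℝ n ψ y).compContinuousLinearMap fun _ => M‖ ≤
      ‖iteratedFDeriv ℝ n ψ y‖ * K ^ ν := by
    refine (ContinuousMultilinearMap.norm_compContinuousLinearMap_le _ _).trans ?_
    rw [Finset.prod_const, Finset.card_univ, Fintype.card_fin]
    gcongr
    exact (pow_le_pow_left₀ (norm_nonneg _) hMK n).trans (pow_le_pow_right₀ hK1 hn)
  calc _ ≤ (2 * (jp b₁ * jp b₂) * (K * jp y)) ^ ν *
        (dilationWeight a ^ 4 * ‖Φ b₁ b₂ s a‖ * (‖iteratedFDeriv ℝ n ψ y‖ * K ^ ν)) := by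
        rw [norm_smul]
        gcongr
    _ = 18 ^ ν * ((jp b₁ * jp b₂) ^ ν * jp s ^ (2 * ν) * dilationWeight a ^ (2 * ν + 4) *
          ‖Φ b₁ b₂ s a‖) * (jp y ^ ν * ‖iteratedFDeriv ℝ n ψ y‖) := by
        rw [show (18 : ℝ) = 2 * 3 * 3 by norm_num, hK]
        simp only [mul_pow]
        ring
    _ ≤ 18 ^ ν * (2 ^ (2 * ν + 6) * pN (ν + 2) (ν + 2) (2 * ν + 2) (2 * ν + 6 : ℕ) 0 0 0 0 Φ *
          cauchyDensity (b₁, b₂, s, a)) * rho ν ψ := by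
        gcongr
        exact le_rho hn ψ y
    _ = _ := by unfold synthConst; ring

theorem ae_dilation_ne_zero : ∀ᵐ p : ℝ × ℝ × ℝ × ℝ, p.2.2.2 ≠ 0 := by
  have h : ∀ᵐ a : ℝ, a ≠ 0 := Measure.ae_ne volume 0
  have h₁ : ∀ᵐ q : ℝ × ℝ, q.2 ≠ 0 := Measure.quasiMeasurePreserving_snd.ae h
  have h₂ : ∀ᵐ q : ℝ × ℝ × ℝ, q.2.2 ≠ 0 := Measure.quasiMeasurePreserving_snd.ae h₁
  exact Measure.quasiMeasurePreserving_snd.ae h₂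

theorem aestronglyMeasurable_synthCoeff {Φ : ℝ → ℝ → ℝ → ℝ → ℂ} (hΦ : MemSS Φ) :
    AEStronglyMeasurable (synthCoeff Φ) volume := by
  have hS : MeasurableSet {p : ℝ × ℝ × ℝ × ℝ | p.2.2.2 ≠ 0} :=
    (measurableSet_eq_fun (by fun_prop) measurable_const).compl
  have h := hΦ.1.continuousOn.aestronglyMeasurable (μ := volume) hS
  rw [Measure.restrict_eq_self_of_ae_mem (s := {p : ℝ × ℝ × ℝ × ℝ | p.2.2.2 ≠ 0})
    ae_dilation_ne_zero] at h
  have hm : Measurable fun p : ℝ × ℝ × ℝ × ℝ =>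
      |p.2.2.2| ^ (-(3 : ℝ)) * |p.2.2.2| ^ (-(3 : ℝ) / 4) := by fun_prop
  exact hm.aestronglyMeasurable.smul h

theorem stronglyMeasurable_shearDilation :
    StronglyMeasurable fun p : ℝ × ℝ × ℝ × ℝ => shearDilation p.2.2.1 p.2.2.2 := by
  have h₁ : Measurable fun p : ℝ × ℝ × ℝ × ℝ => p.2.2.2⁻¹ := by fun_prop
  have h₂ : Measurable fun p : ℝ × ℝ × ℝ × ℝ => p.2.2.1 * p.2.2.2⁻¹ := by fun_prop
  have h₃ : Measurable fun p : ℝ × ℝ × ℝ × ℝ => √|p.2.2.2| * p.2.2.2⁻¹ := by fun_prop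
  exact ((h₁.stronglyMeasurable.smul_const _).add (h₂.stronglyMeasurable.smul_const _)).add
    (h₃.stronglyMeasurable.smul_const _)

theorem continuous_e2 : Continuous fun q : ℝ × ℝ => e2 q.1 q.2 := by
  unfold e2
  refine (PiLp.continuous_toLp 2 _).comp ?_
  fun_prop

theorem stronglyMeasurable_shearDilation_apply :
    StronglyMeasurable fun z : E2 × ℝ × ℝ × ℝ × ℝ =>
      shearDilation z.2.2.2.1 z.2.2.2.2 (z.1 - e2 z.2.1 z.2.2.1) := by
  have hc : Continuous fun q : (E2 →L[ℝ] E2) × E2 => q.1 q.2 := by fun_prop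
  have hb : Continuous fun z : E2 × ℝ × ℝ × ℝ × ℝ => z.1 - e2 z.2.1 z.2.2.1 :=
    continuous_fst.sub (continuous_e2.comp (by fun_prop : Continuous
      fun z : E2 × ℝ × ℝ × ℝ × ℝ => (z.2.1, z.2.2.1)))
  exact hc.comp_stronglyMeasurable
    ((stronglyMeasurable_shearDilation.comp_measurable measurable_snd).prodMk
      hb.stronglyMeasurable)

theorem aestronglyMeasurable_synthAtom {Φ : ℝ → ℝ → ℝ → ℝ → ℂ} (hΦ : MemSS Φ) {ψ : E2 → ℂ}
    (hψ : Continuous ψ) :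
    AEStronglyMeasurable (fun z : E2 × ℝ × ℝ × ℝ × ℝ => synthAtom ψ Φ z.2 z.1)
      (volume.prod volume) :=
  (aestronglyMeasurable_synthCoeff hΦ).comp_snd.smul
    (hψ.comp_stronglyMeasurable stronglyMeasurable_shearDilation_apply).aestronglyMeasurable

theorem aestronglyMeasurable_iteratedFDeriv_synthAtom {Φ : ℝ → ℝ → ℝ → ℝ → ℂ} (hΦ : MemSS Φ)
    {ψ : E2 → ℂ} (hψ : ContDiff ℝ (⊤ : ℕ∞) ψ) (n : ℕ) (x : E2) :
    AEStronglyMeasurable (fun p => iteratedFDeriv ℝ n (synthAtom ψ Φ p) x) volume := by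
  simp_rw [iteratedFDeriv_synthAtom hψ]
  refine (aestronglyMeasurable_synthCoeff hΦ).smul (StronglyMeasurable.aestronglyMeasurable ?_)
  have hc : Continuous fun q : ContinuousMultilinearMap ℝ (fun _ : Fin n => E2) ℂ ×
      (E2 →L[ℝ] E2) => q.1.compContinuousLinearMap fun _ => q.2 := by
    have h : Continuous fun q : ContinuousMultilinearMap ℝ (fun _ : Fin n => E2) ℂ ×
        (E2 →L[ℝ] E2) => ContinuousMultilinearMap.compContinuousLinearMapContinuousMultilinear ℝ
          (fun _ : Fin n => E2) (fun _ : Fin n => E2) ℂ fun _ => q.2 :=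
      (ContinuousMultilinearMap.cont _).comp (by fun_prop)
    exact h.clm_apply continuous_fst
  have hn : (n : WithTop ℕ∞) ≤ (⊤ : ℕ∞) := by exact_mod_cast le_top
  exact hc.comp_stronglyMeasurable (((hψ.continuous_iteratedFDeriv hn).comp_stronglyMeasurable
    (stronglyMeasurable_shearDilation_apply.comp_measurable
      (measurable_const.prodMk measurable_id))).prodMk stronglyMeasurable_shearDilation)

theorem hasFTaylorSeriesUpTo_sSynth {Φ : ℝ → ℝ → ℝ → ℝ → ℂ} (hΦ : MemSS Φ)
    (ψ : SchwartzMap E2 ℂ) :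
    HasFTaylorSeriesUpTo (⊤ : ℕ∞) (sSynth ψ Φ)
      (fun x n => ∫ p, iteratedFDeriv ℝ n (synthAtom ψ Φ p) x) := by
  rw [sSynth_eq]
  refine hasFTaylorSeriesUpTo_integral (fun p => contDiff_synthAtom (ψ.smooth _) Φ p)
    (aestronglyMeasurable_iteratedFDeriv_synthAtom hΦ (ψ.smooth _))
    (fun n p x => ?_) (fun n => integrable_cauchyDensity.const_mul (synthConst n *
      pN (n + 2) (n + 2) (2 * n + 2) (2 * n + 6 : ℕ) 0 0 0 0 Φ * rho n ψ))
  exact (le_mul_of_one_le_left (norm_nonneg _) (one_le_pow₀ (one_le_jp x))).trans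
    (jp_pow_mul_norm_iteratedFDeriv_synthAtom_le hΦ ψ le_rfl p x)

theorem jp_pow_mul_norm_iteratedFDeriv_sSynth_le {Φ : ℝ → ℝ → ℝ → ℝ → ℂ} (hΦ : MemSS Φ)
    (ψ : SchwartzMap E2 ℂ) {ν n : ℕ} (hn : n ≤ ν) (x : E2) :
    jp x ^ ν * ‖iteratedFDeriv ℝ n (sSynth ψ Φ) x‖ ≤
      synthConst ν * pN (ν + 2) (ν + 2) (2 * ν + 2) (2 * ν + 6 : ℕ) 0 0 0 0 Φ * rho ν ψ *
        ∫ p, cauchyDensity p := by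
  have hx := pow_pos (jp_pos x) ν
  rw [← (hasFTaylorSeriesUpTo_sSynth hΦ ψ).eq_iteratedFDeriv (by exact_mod_cast le_top) x,
    ← integral_const_mul]
  calc _ = ‖∫ p, jp x ^ ν • iteratedFDeriv ℝ n (synthAtom ψ Φ p) x‖ := by
        rw [integral_smul, norm_smul, Real.norm_of_nonneg hx.le]
    _ ≤ _ := by
        refine norm_integral_le_of_norm_le (integrable_cauchyDensity.const_mul _)
          (Filter.Eventually.of_forall fun p => ?_)
        rw [norm_smul, Real.norm_of_nonneg hx.le]
        exact jp_pow_mul_norm_iteratedFDeriv_synthAtom_le hΦ ψ hn p x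

theorem exists_schwartzMap_eq_sSynth {Φ : ℝ → ℝ → ℝ → ℝ → ℂ} (hΦ : MemSS Φ)
    (ψ : SchwartzMap E2 ℂ) : ∃ g : SchwartzMap E2 ℂ, ⇑g = sSynth ψ Φ := by
  refine ⟨⟨sSynth ψ Φ, (hasFTaylorSeriesUpTo_sSynth hΦ ψ).contDiff, fun k n => ⟨_, fun x =>
    le_trans ?_ (jp_pow_mul_norm_iteratedFDeriv_sSynth_le hΦ ψ (le_max_right k n) x)⟩⟩, rfl⟩
  gcongr
  exact (pow_le_pow_left₀ (norm_nonneg x) (norm_le_jp x) k).trans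
    (pow_le_pow_right₀ (one_le_jp x) (le_max_left k n))

theorem abs_monomial_le (x : E2) (m₁ m₂ : ℕ) : |x 0 ^ m₁ * x 1 ^ m₂| ≤ ‖x‖ ^ (m₁ + m₂) := by
  rw [abs_mul, abs_pow, abs_pow, pow_add]
  gcongr <;> exact abs_apply_le x _

theorem integrable_monomial_smul (ψ : SchwartzMap E2 ℂ) (m₁ m₂ : ℕ) :
    Integrable fun x : E2 => (x 0 ^ m₁ * x 1 ^ m₂ : ℝ) • ψ x := by
  refine (ψ.integrable_pow_mul volume (m₁ + m₂)).mono'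
    (Continuous.aestronglyMeasurable ?_) (Filter.Eventually.of_forall fun x => ?_)
  · have := ψ.continuous
    fun_prop
  · rw [norm_smul, Real.norm_eq_abs]
    gcongr
    exact abs_monomial_le x m₁ m₂

/-- A Schwartz function with vanishing moments is orthogonal to all polynomials. -/
theorem integral_eval_smul_eq_zero (ψ : SchwartzMap E2 ℂ)
    (hψ : ∀ m₁ m₂ : ℕ, ∫ x : E2, (x 0 ^ m₁ * x 1 ^ m₂ : ℝ) • ψ x = 0)
    (q : MvPolynomial (Fin 2) ℝ) :
    ∫ x : E2, MvPolynomial.eval (fun i => x i) q • ψ x = 0 := by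
  suffices h : Integrable (fun x : E2 => MvPolynomial.eval (fun i => x i) q • ψ x) ∧
      ∫ x : E2, MvPolynomial.eval (fun i => x i) q • ψ x = 0 from h.2
  induction q using MvPolynomial.induction_on' with
  | monomial u c =>
    have h : ∀ x : E2, MvPolynomial.eval (fun i => x i) (MvPolynomial.monomial u c) • ψ x =
        c • (x 0 ^ u 0 * x 1 ^ u 1 : ℝ) • ψ x := fun x => by
      rw [MvPolynomial.eval_monomial, Finsupp.prod_fintype _ _ (by simp), Fin.prod_univ_two,
        smul_smul]
    simp_rw [h]
    exact ⟨(integrable_monomial_smul ψ _ _).smul c, by rw [integral_smul, hψ, smul_zero]⟩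
  | add q r hq hr =>
    simp_rw [map_add, add_smul]
    exact ⟨hq.1.add hr.1, by rw [integral_add hq.1 hr.1, hq.2, hr.2, add_zero]⟩

theorem shearDilation_injective {a : ℝ} (ha : a ≠ 0) (s : ℝ) :
    Function.Injective (shearDilation s a) := by
  refine (injective_iff_map_eq_zero _).2 fun x hx => norm_le_zero_iff.1 ?_
  simpa [hx] using norm_le_norm_shearDilation_apply ha s x

theorem integral_comp_shearDilation_sub_eq_zero {a : ℝ} (ha : a ≠ 0) (s : ℝ) (b : E2) {f : E2 → ℂ}
    (hf : ∫ x, f x = 0) : ∫ x, f (shearDilation s a (x - b)) = 0 := by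
  rw [integral_sub_right_eq_self fun x => f (shearDilation s a x)]
  let M : E2 →ₗ[ℝ] E2 := (shearDilation s a).toLinearMap
  have hM : LinearMap.det M ≠ 0 :=
    (LinearEquiv.isUnit_det' (LinearEquiv.ofInjectiveEndo M (shearDilation_injective ha s))).ne_zero
  have hemb : MeasurableEmbedding (shearDilation s a) :=
    (LinearMap.isClosedEmbedding_of_injective
      (LinearMap.ker_eq_bot.2 (shearDilation_injective ha s) : M.ker = ⊥)).measurableEmbedding
  have hmap : Measure.map (shearDilation s a) volume = _ :=
    Measure.map_linearMap_addHaar_eq_smul_addHaar (volume : Measure E2) hM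
  rw [← hemb.integral_map f, hmap, integral_smul_measure, hf, smul_zero]

theorem integral_monomial_smul_synthAtom (ψ : SchwartzMap E2 ℂ)
    (hψ : ∀ m₁ m₂ : ℕ, ∫ x : E2, (x 0 ^ m₁ * x 1 ^ m₂ : ℝ) • ψ x = 0)
    (Φ : ℝ → ℝ → ℝ → ℝ → ℂ) (p : ℝ × ℝ × ℝ × ℝ) (m₁ m₂ : ℕ) :
    ∫ x : E2, (x 0 ^ m₁ * x 1 ^ m₂ : ℝ) • synthAtom ψ Φ p x = 0 := by
  rcases eq_or_ne p.2.2.2 0 with ha | ha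
  · simp [synthAtom, synthCoeff_eq_zero Φ ha]
  obtain ⟨b₁, b₂, s, a⟩ := p
  dsimp only at ha
  simp only [synthAtom, smul_comm _ (synthCoeff Φ (b₁, b₂, s, a)), integral_smul]
  have hr : √|a| ≠ 0 := (Real.sqrt_pos.2 (abs_pos.2 ha)).ne'
  let q : MvPolynomial (Fin 2) ℝ :=
    (.C a * .X 0 - .C (s * (a / √|a|)) * .X 1 + .C b₁) ^ m₁ * (.C (a / √|a|) * .X 1 + .C b₂) ^ m₂
  have hq : ∀ x : E2, MvPolynomial.eval (fun i => shearDilation s a (x - e2 b₁ b₂) i) q =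
      x 0 ^ m₁ * x 1 ^ m₂ := fun x => by
    simp only [q, map_mul, map_pow, map_add, MvPolynomial.eval_sub, MvPolynomial.eval_C,
      MvPolynomial.eval_X, shearDilation_zero, shearDilation_one, PiLp.sub_apply, e2_zero, e2_one]
    congr 2 <;> field_simp <;> ring
  simp_rw [← hq]
  rw [integral_comp_shearDilation_sub_eq_zero ha s (e2 b₁ b₂)
    (f := fun y => MvPolynomial.eval (fun i => y i) q • ψ y)
    (integral_eval_smul_eq_zero ψ hψ q), smul_zero]

theorem integrable_monomial_smul_synthAtom {Φ : ℝ → ℝ → ℝ → ℝ → ℂ} (hΦ : MemSS Φ)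
    (ψ : SchwartzMap E2 ℂ) (m₁ m₂ : ℕ) :
    Integrable (fun z : E2 × ℝ × ℝ × ℝ × ℝ =>
      (z.1 0 ^ m₁ * z.1 1 ^ m₂ : ℝ) • synthAtom ψ Φ z.2 z.1) (volume.prod volume) := by
  let ν := m₁ + m₂ + 3
  have hb : Integrable fun x : E2 => (1 + ‖x‖) ^ (-(3 : ℝ)) :=
    integrable_one_add_norm (by simp; norm_num)
  have hm : Continuous fun z : E2 × ℝ × ℝ × ℝ × ℝ => z.1 0 ^ m₁ * z.1 1 ^ m₂ := by fun_prop
  refine ((hb.const_mul 8).mul_prod (integrable_cauchyDensity.const_mul (synthConst ν *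
    pN (ν + 2) (ν + 2) (2 * ν + 2) (2 * ν + 6 : ℕ) 0 0 0 0 Φ * rho ν ψ))).mono'
    (hm.aestronglyMeasurable.smul (aestronglyMeasurable_synthAtom hΦ ψ.continuous))
    (Filter.Eventually.of_forall fun z => ?_)
  obtain ⟨x, p⟩ := z
  have h := jp_pow_mul_norm_iteratedFDeriv_synthAtom_le hΦ ψ (Nat.zero_le ν) p x
  rw [norm_iteratedFDeriv_zero] at h
  have hx := jp_pos x
  have h8 : (jp x ^ 3)⁻¹ ≤ 8 * (1 + ‖x‖) ^ (-(3 : ℝ)) := by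
    rw [Real.rpow_neg (by positivity), show (3 : ℝ) = (3 : ℕ) by norm_num, Real.rpow_natCast,
      ← div_eq_mul_inv, le_div_iff₀ (by positivity), inv_mul_le_iff₀ (by positivity)]
    calc (1 + ‖x‖) ^ 3 ≤ (2 * jp x) ^ 3 := by
          gcongr
          exact one_add_norm_le_two_mul_jp x
      _ = _ := by ring
  rw [norm_smul, Real.norm_eq_abs]
  calc _ ≤ jp x ^ (m₁ + m₂) * ‖synthAtom ψ Φ p x‖ := by
        gcongr
        exact (abs_monomial_le x m₁ m₂).trans (by gcongr; exact norm_le_jp x)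
    _ = (jp x ^ 3)⁻¹ * (jp x ^ ν * ‖synthAtom ψ Φ p x‖) := by
        simp only [ν, pow_add]
        field_simp
    _ ≤ _ := by gcongr

theorem integral_monomial_smul_sSynth {Φ : ℝ → ℝ → ℝ → ℝ → ℂ} (hΦ : MemSS Φ)
    (ψ : SchwartzMap E2 ℂ)
    (hψ : ∀ m₁ m₂ : ℕ, ∫ x : E2, (x 0 ^ m₁ * x 1 ^ m₂ : ℝ) • ψ x = 0) (m₁ m₂ : ℕ) :
    ∫ x : E2, (x 0 ^ m₁ * x 1 ^ m₂ : ℝ) • sSynth ψ Φ x = 0 := by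
  simp_rw [sSynth_eq, ← integral_smul]
  rw [integral_integral_swap (integrable_monomial_smul_synthAtom hΦ ψ m₁ m₂)]
  simp_rw [integral_monomial_smul_synthAtom ψ hψ, integral_zero]

/-- the shearlet synthesis operator is a continuous bilinear map from
𝒮(𝕊) × S₀(ℝ²) into S₀(ℝ²). -/
theorem synthesis_continuous :
    (∀ (Φ : ℝ → ℝ → ℝ → ℝ → ℂ) (ψ : E2 → ℂ),
        MemSS Φ → IsLizorkin2 ψ → IsLizorkin2 (sSynth ψ Φ)) ∧
    ∀ ν : ℕ, ∃ (k₁ k₂ l m α₁ α₂ β γ ν₂ : ℕ) (C : ℝ), 0 < C ∧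
      ∀ (Φ : ℝ → ℝ → ℝ → ℝ → ℂ) (ψ : E2 → ℂ), MemSS Φ → IsLizorkin2 ψ →
        rho ν (sSynth ψ Φ) ≤ C * pN k₁ k₂ l (m : ℝ) α₁ α₂ β γ Φ * rho ν₂ ψ := by
  refine ⟨?_, fun ν => ⟨ν + 2, ν + 2, 2 * ν + 2, 2 * ν + 6, 0, 0, 0, 0, ν,
    synthConst ν * (∫ p, cauchyDensity p) + 1, ?_, ?_⟩⟩
  · rintro Φ _ hΦ ⟨⟨ψ, rfl⟩, hψ⟩
    exact ⟨exists_schwartzMap_eq_sSynth hΦ ψ, integral_monomial_smul_sSynth hΦ ψ hψ⟩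
  · have : 0 ≤ ∫ p, cauchyDensity p := integral_nonneg fun p => cauchyDensity_nonneg p
    unfold synthConst
    positivity
  · rintro Φ _ hΦ ⟨⟨ψ, rfl⟩, -⟩
    have hP := pN_nonneg hΦ (ν + 2) (ν + 2) (2 * ν + 2) (2 * ν + 6)
    have hρ := rho_nonneg ν ψ
    refine ciSup_le fun q => (jp_pow_mul_norm_iteratedFDeriv_sSynth_le hΦ ψ
      (Nat.lt_succ_iff.1 q.2.2) q.1).trans ?_
    nlinarith [mul_nonneg hP hρ]

end
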